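/- Let a = (w_1, …, w_n) be a weak CLT sentence, i.e. each w_i is a closed word starting at the letter 1, N_e^a ≥ 2 for all e ∈ E_a, and for every index i there exists j ≠ i with E_{w_i} ∩ E_{w_j} ≠ ∅. Then wt(a) ≤ 1 + Σ_{i=1}^n (ℓ(w_i) − 2)/2. -/

import Mathlib

/-- The list of edges (unordered pairs of adjacent letters) traversed by the word `w`. -/
def edgeList (w : List ℕ) : List (Sym2 ℕ) :=
  (w.zip w.tail).map fun p => s(p.1, p.2)

/-- The edge set `E_w` of the graph `G_w` of the word `w`. -/
def edgeFinset (w : List ℕ) : Finset (Sym2 ℕ) := (edgeList w).toFinset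

/-- The traversal count `N_e^w`: the number of times the walk `w` traverses the edge `e`
(in either direction). -/
def trav (w : List ℕ) (e : Sym2 ℕ) : ℕ := (edgeList w).count e

/-- The support of a word: the set of letters appearing in it. -/
def wsupp (w : List ℕ) : Finset ℕ := w.toFinset

/-- A word is a closed word starting at the letter `1`: a finite sequence of positive
integers whose first and last letters are both equal to `1`. -/
def IsClosedWordAtOne (w : List ℕ) : Prop :=
  w ≠ [] ∧ w.head? = some 1 ∧ w.getLast? = some 1 ∧ ∀ x ∈ w, 0 < x

/-- `(w₁, w₂)` is a weak CLT pair: both are closed words starting at `1`, every edge of the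
combined graph is traversed at least twice in total, and the two words share an edge. -/
def IsWeakCLTPair (w₁ w₂ : List ℕ) : Prop :=
  IsClosedWordAtOne w₁ ∧ IsClosedWordAtOne w₂ ∧
    (∀ e ∈ edgeFinset w₁ ∪ edgeFinset w₂, 2 ≤ trav w₁ e + trav w₂ e) ∧
    (edgeFinset w₁ ∩ edgeFinset w₂).Nonempty


/-- The list of all edge-traversals of the sentence `a = (w₁, …, wₙ)`. -/
def sentEdgeList (a : List (List ℕ)) : List (Sym2 ℕ) := (a.map edgeList).flatten

/-- The edge set `E_a` of the graph `G_a` of the sentence `a`. -/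
def sentEdgeFinset (a : List (List ℕ)) : Finset (Sym2 ℕ) := (sentEdgeList a).toFinset

/-- The total traversal count `N_e^a` of the edge `e` by the walks of the sentence `a`. -/
def sentTrav (a : List (List ℕ)) (e : Sym2 ℕ) : ℕ := (sentEdgeList a).count e

/-- The support of a sentence: the union of the supports of its words. -/
def sentSupp (a : List (List ℕ)) : Finset ℕ := a.flatten.toFinset

/-- `a = (w₁, …, wₙ)` is a weak CLT sentence: it consists of at least one word, all its words
are closed words starting at `1`, every edge of `G_a` is traversed at least twice in total,
and every word shares an edge with some other word of the sentence. -/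
def IsWeakCLTSentence (a : List (List ℕ)) : Prop :=
  a ≠ [] ∧ (∀ w ∈ a, IsClosedWordAtOne w) ∧
    (∀ e ∈ sentEdgeFinset a, 2 ≤ sentTrav a e) ∧
    ∀ i : Fin a.length, ∃ j : Fin a.length, j ≠ i ∧
      (edgeFinset (a.get i) ∩ edgeFinset (a.get j)).Nonempty

/-- `a` is a CLT sentence: a weak CLT sentence with
`wt(a) = 1 + Σᵢ (ℓ(wᵢ) - 2)/2`. -/
def IsCLTSentence (a : List (List ℕ)) : Prop :=
  IsWeakCLTSentence a ∧
    ((sentSupp a).card : ℚ) = 1 + ∑ i : Fin a.length, (((a.get i).length : ℚ) - 2) / 2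

/-- `T` is the edge set of a spanning tree of `V`: it has one edge fewer than `V` has vertices,
and every edge `e ∈ T` is the only edge of `T` crossing some cut `f`. -/
def IsCutTree (V : Finset ℕ) (T : Finset (Sym2 ℕ)) : Prop :=
  T.card + 1 = V.card ∧ (∀ e ∈ T, ∀ x ∈ e, x ∈ V) ∧
    ∀ e ∈ T, ∃ f : ℕ → ZMod 2, ∀ x y, s(x, y) ∈ T → f x + f y = if s(x, y) = e then 1 else 0

lemma edgeList_singleton (x : ℕ) : edgeList [x] = [] := rfl

lemma edgeList_cons_cons (x y : ℕ) (l : List ℕ) :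
    edgeList (x :: y :: l) = s(x, y) :: edgeList (y :: l) := rfl

lemma length_edgeList (w : List ℕ) : (edgeList w).length = w.length - 1 := by
  simp [edgeList]

lemma isCutTree_singleton (x : ℕ) : IsCutTree {x} ∅ := by
  simp [IsCutTree]

/-- Attaching a new leaf to a spanning tree. -/
lemma IsCutTree.insert_leaf {V : Finset ℕ} {T : Finset (Sym2 ℕ)} (h : IsCutTree V T) {x y : ℕ}
    (hx : x ∈ V) (hy : y ∉ V) : IsCutTree (insert y V) (insert s(x, y) T) := by
  obtain ⟨hcard, hV, hcut⟩ := h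
  have hyT : ∀ e ∈ T, y ∉ e := fun e he hye => hy (hV e he y hye)
  have hnew : s(x, y) ∉ T := fun hm => hyT _ hm (Sym2.mem_mk_right x y)
  have hxy : x ≠ y := fun hxy => hy (hxy ▸ hx)
  refine ⟨?_, ?_, ?_⟩
  · rw [Finset.card_insert_of_notMem hnew, Finset.card_insert_of_notMem hy, hcard]
  · intro e he z hz
    rcases Finset.mem_insert.1 he with rfl | he
    · rcases Sym2.mem_iff.1 hz with rfl | rfl
      · exact Finset.mem_insert_of_mem hx
      · exact Finset.mem_insert_self _ _
    · exact Finset.mem_insert_of_mem (hV e he z hz)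
  · intro e he
    rcases Finset.mem_insert.1 he with rfl | he
    · refine ⟨Pi.single y 1, fun u v huv => ?_⟩
      rcases Finset.mem_insert.1 huv with huv | huv
      · rw [if_pos huv]
        rcases Sym2.eq_iff.1 huv with ⟨rfl, rfl⟩ | ⟨rfl, rfl⟩ <;> simp [hxy]
      · have hne : s(u, v) ≠ s(x, y) := fun he => hnew (he ▸ huv)
        have hu : u ≠ y := fun h => hyT _ huv (h ▸ Sym2.mem_mk_left u v)
        have hv : v ≠ y := fun h => hyT _ huv (h ▸ Sym2.mem_mk_right u v)
        simp [hne, hu, hv]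
    · obtain ⟨f, hf⟩ := hcut e he
      refine ⟨Function.update f y (f x), fun u v huv => ?_⟩
      rcases Finset.mem_insert.1 huv with huv | huv
      · have hne : s(u, v) ≠ e := fun h => hnew (by rwa [← huv, h])
        rw [if_neg hne]
        rcases Sym2.eq_iff.1 huv with ⟨rfl, rfl⟩ | ⟨rfl, rfl⟩ <;>
          simp [hxy, CharTwo.add_self_eq_zero]
      · have hu : u ≠ y := fun h => hyT _ huv (h ▸ Sym2.mem_mk_left u v)
        have hv : v ≠ y := fun h => hyT _ huv (h ▸ Sym2.mem_mk_right u v)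
        simpa [hu, hv] using hf u v huv

/-- Extending a spanning tree along a walk that starts at one of its vertices. -/
lemma IsCutTree.exists_extend_walk {V : Finset ℕ} {T : Finset (Sym2 ℕ)} (h : IsCutTree V T)
    {x : ℕ} {l : List ℕ} (hx : x ∈ V) :
    ∃ T', IsCutTree (V ∪ (x :: l).toFinset) T' ∧ T' ⊆ T ∪ (edgeList (x :: l)).toFinset := by
  induction l generalizing V T x with
  | nil =>
    refine ⟨T, ?_, Finset.subset_union_left⟩
    rwa [Finset.union_eq_left.2 (by simpa using hx)]
  | cons y l ih =>
    have hV : insert y V ∪ (y :: l).toFinset = V ∪ (x :: y :: l).toFinset := by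
      ext z
      simp only [Finset.mem_union, Finset.mem_insert, List.mem_toFinset, List.mem_cons]
      grind
    by_cases hy : y ∈ V
    · obtain ⟨T', hT', hsub⟩ := ih h hy
      refine ⟨T', ?_, hsub.trans ?_⟩
      · rwa [← hV, Finset.insert_eq_of_mem hy]
      · rw [edgeList_cons_cons, List.toFinset_cons]
        exact Finset.union_subset_union_right (Finset.subset_insert _ _)
    · obtain ⟨T', hT', hsub⟩ := ih (h.insert_leaf hx hy) (Finset.mem_insert_self y V)
      refine ⟨T', hV ▸ hT', hsub.trans ?_⟩
      rw [edgeList_cons_cons, List.toFinset_cons, Finset.insert_union, Finset.union_insert]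

lemma IsCutTree.exists_extend_sentence {V : Finset ℕ} {T : Finset (Sym2 ℕ)} (h : IsCutTree V T)
    {x : ℕ} (hx : x ∈ V) {a : List (List ℕ)} (ha : ∀ w ∈ a, w.head? = some x) :
    ∃ T', IsCutTree (V ∪ sentSupp a) T' ∧ T' ⊆ T ∪ sentEdgeFinset a := by
  induction a generalizing V T with
  | nil => exact ⟨T, by simpa [sentSupp] using h, Finset.subset_union_left⟩
  | cons w a ih =>
    obtain ⟨l, rfl⟩ := List.head?_eq_some_iff.1 (ha w List.mem_cons_self)
    obtain ⟨T₁, hT₁, hsub₁⟩ := h.exists_extend_walk (l := l) hx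
    obtain ⟨T₂, hT₂, hsub₂⟩ := ih hT₁ (Finset.mem_union_left _ hx)
      fun w hw => ha w (List.mem_cons_of_mem _ hw)
    refine ⟨T₂, ?_, fun e he => ?_⟩
    · have hsupp : sentSupp ((x :: l) :: a) = (x :: l).toFinset ∪ sentSupp a := by
        rw [sentSupp, List.flatten_cons, List.toFinset_append, sentSupp]
      rwa [hsupp, ← Finset.union_assoc]
    · have hedge : sentEdgeFinset ((x :: l) :: a)
          = (edgeList (x :: l)).toFinset ∪ sentEdgeFinset a := by
        rw [sentEdgeFinset, sentEdgeList, List.map_cons, List.flatten_cons, List.toFinset_append,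
          sentEdgeFinset, sentEdgeList]
      rw [hedge, ← Finset.union_assoc]
      exact Finset.union_subset_union_left hsub₁ (hsub₂ he)

/-- A walk all of whose edges lie in `T` crosses the cut `f` as often, modulo two, as its
endpoints tell. -/
lemma count_edgeList_eq_of_cut {T : Finset (Sym2 ℕ)} {e : Sym2 ℕ} {f : ℕ → ZMod 2}
    (hf : ∀ x y, s(x, y) ∈ T → f x + f y = if s(x, y) = e then 1 else 0) (x : ℕ) (l : List ℕ)
    (hl : ∀ e' ∈ edgeList (x :: l), e' ∈ T) :
    ((edgeList (x :: l)).count e : ZMod 2) =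
      f x + f ((x :: l).getLast (List.cons_ne_nil x l)) := by
  induction l generalizing x with
  | nil => simp [edgeList_singleton, CharTwo.add_self_eq_zero]
  | cons y l ih =>
    rw [edgeList_cons_cons] at hl ⊢
    have hxy := hf x y (hl _ List.mem_cons_self)
    have hcount : (((s(x, y) :: edgeList (y :: l)).count e : ℕ) : ZMod 2)
        = (edgeList (y :: l)).count e + (f x + f y) := by
      rw [hxy, List.count_cons]
      simp
    rw [hcount, ih y fun e' he' => hl e' (List.mem_cons_of_mem _ he'), List.getLast_cons_cons]
    linear_combination CharTwo.add_self_eq_zero (f y)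

/-- A closed walk inside a tree traverses every edge an even number of times. -/
lemma IsCutTree.even_trav {V : Finset ℕ} {T : Finset (Sym2 ℕ)} (h : IsCutTree V T)
    {w : List ℕ} {x : ℕ} (hhead : w.head? = some x) (hlast : w.getLast? = some x)
    (hw : ∀ e ∈ edgeFinset w, e ∈ T) (e : Sym2 ℕ) : Even (trav w e) := by
  by_cases he : e ∈ T
  · obtain ⟨f, hf⟩ := h.2.2 e he
    obtain ⟨l, rfl⟩ := List.head?_eq_some_iff.1 hhead
    rw [List.getLast?_eq_some_getLast (List.cons_ne_nil x l), Option.some_inj] at hlast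
    have hcount := count_edgeList_eq_of_cut hf x l fun e' he' => hw e' (List.mem_toFinset.2 he')
    rw [hlast, CharTwo.add_self_eq_zero] at hcount
    exact (ZMod.natCast_eq_zero_iff_even).1 hcount
  · have h0 : trav w e = 0 := List.count_eq_zero.2 fun hm => he (hw e (List.mem_toFinset.2 hm))
    simp [h0]

/-- A double counting bound for the incidence table `c` of words and edges. -/
lemma two_mul_card_add_card_le_sum {ι ε : Type*} [Fintype ι] [DecidableEq ι] [DecidableEq ε]
    (c : ι → ε → ℕ) {T E : Finset ε} (hTE : T ⊆ E) (htwo : ∀ e ∈ E, 2 ≤ ∑ i, c i e)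
    (heven : ∀ i, (∀ e ∈ E \ T, c i e = 0) → ∀ e, Even (c i e))
    (hshare : ∀ i, ∃ j, j ≠ i ∧ ∃ e ∈ E, c i e ≠ 0 ∧ c j e ≠ 0) :
    2 * T.card + Fintype.card ι ≤ ∑ i, ∑ e ∈ E, c i e := by
  choose p hp g hgE hg hgp using hshare
  set S : Finset ι := {i | ∀ e ∈ E \ T, c i e = 0} with hS
  have hout : Sᶜ.card ≤ ∑ i, ∑ e ∈ E \ T, c i e := by
    calc Sᶜ.card = ∑ i ∈ Sᶜ, 1 := by simp
      _ ≤ ∑ i ∈ Sᶜ, ∑ e ∈ E \ T, c i e := by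
        refine Finset.sum_le_sum fun i hi => ?_
        rw [Nat.one_le_iff_ne_zero]
        intro h0
        simp only [hS, Finset.mem_compl, Finset.mem_filter, Finset.mem_univ, true_and] at hi
        exact hi (Finset.sum_eq_zero_iff.1 h0)
      _ ≤ _ := Finset.sum_le_sum_of_subset (Finset.subset_univ _)
  have htwo_le : ∀ i ∈ S, 2 ≤ c i (g i) := by
    intro i hi
    obtain ⟨k, hk⟩ := heven i (Finset.mem_filter.1 hi).2 (g i)
    have := hg i
    omega
  have hmaps : ∀ i ∈ S, g i ∈ T := by
    intro i hi
    by_contra hT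
    exact hg i ((Finset.mem_filter.1 hi).2 _ (Finset.mem_sdiff.2 ⟨hgE i, hT⟩))
  have hedge : ∀ e ∈ T, 2 + (S.filter fun i => g i = e).card ≤ ∑ i, c i e := by
    intro e he
    set F := S.filter fun i => g i = e with hF
    have hF_two : ∀ i ∈ F, 2 ≤ c i e := by
      intro i hi
      obtain ⟨hiS, rfl⟩ := Finset.mem_filter.1 hi
      exact htwo_le i hiS
    have hFsum : 2 * F.card ≤ ∑ i, c i e :=
      calc 2 * F.card = ∑ i ∈ F, 2 := by simp [mul_comm]
        _ ≤ ∑ i ∈ F, c i e := Finset.sum_le_sum hF_two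
        _ ≤ _ := Finset.sum_le_sum_of_subset (Finset.subset_univ _)
    have hEsum := htwo e (hTE he)
    rcases lt_trichotomy F.card 1 with h | h | h
    · omega
    · obtain ⟨i, hi⟩ := Finset.card_eq_one.1 h
      have hiF : i ∈ F := hi ▸ Finset.mem_singleton_self i
      have hc := hF_two i hiF
      have hc' : c (p i) e ≠ 0 := (Finset.mem_filter.1 hiF).2 ▸ hgp i
      have hpair : c i e + c (p i) e ≤ ∑ i, c i e := by
        rw [← Finset.sum_pair (f := fun i => c i e) (hp i).symm]
        exact Finset.sum_le_sum_of_subset (Finset.subset_univ _)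
      omega
    · omega
  have hin : 2 * T.card + S.card ≤ ∑ i, ∑ e ∈ T, c i e := by
    rw [Finset.sum_comm, Finset.card_eq_sum_card_fiberwise hmaps]
    calc _ = ∑ e ∈ T, (2 + (S.filter fun i => g i = e).card) := by
          simp [Finset.sum_add_distrib, mul_comm]
      _ ≤ _ := Finset.sum_le_sum hedge
  have hsplit : ∑ i, ∑ e ∈ E, c i e = ∑ i, ∑ e ∈ E \ T, c i e + ∑ i, ∑ e ∈ T, c i e := by
    rw [← Finset.sum_add_distrib]
    exact Finset.sum_congr rfl fun i _ => (Finset.sum_sdiff hTE).symm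
  have hcompl := Finset.card_add_card_compl S
  omega

lemma edgeFinset_subset_sentEdgeFinset {a : List (List ℕ)} {w : List ℕ} (hw : w ∈ a) :
    edgeFinset w ⊆ sentEdgeFinset a := fun _ he =>
  List.mem_toFinset.2 (List.mem_flatten_of_mem (List.mem_map_of_mem hw) (List.mem_toFinset.1 he))

lemma sum_trav_eq_length {w : List ℕ} {E : Finset (Sym2 ℕ)} (h : edgeFinset w ⊆ E) :
    ∑ e ∈ E, trav w e = w.length - 1 := by
  rw [← length_edgeList, ← List.sum_toFinset_count_eq_length]
  refine (Finset.sum_subset h fun e _ he => List.count_eq_zero.2 fun hm => ?_).symm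
  exact he (List.mem_toFinset.2 hm)

lemma sentTrav_eq_sum (a : List (List ℕ)) (e : Sym2 ℕ) :
    sentTrav a e = ∑ i : Fin a.length, trav (a.get i) e := by
  rw [sentTrav, sentEdgeList, List.count_flatten, List.map_map, ← Fin.sum_univ_fun_getElem]
  rfl

/-- **Weight bound for weak CLT sentences.** If `a = (w₁, …, wₙ)` is a weak CLT sentence,
then `wt(a) ≤ 1 + Σᵢ (ℓ(wᵢ) - 2)/2`. -/
theorem weak_CLT_sentence_weight_bound (a : List (List ℕ)) (h : IsWeakCLTSentence a) :
    ((sentSupp a).card : ℚ) ≤ 1 + ∑ i : Fin a.length, (((a.get i).length : ℚ) - 2) / 2 := by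
  obtain ⟨-, hclosed, htwo, hshare⟩ := h
  obtain ⟨T, hT, hTE⟩ := (isCutTree_singleton 1).exists_extend_sentence
    (Finset.mem_singleton_self 1) fun w hw => (hclosed w hw).2.1
  rw [Finset.empty_union] at hTE
  have hpos : ∀ i : Fin a.length, 1 ≤ (a.get i).length := fun i =>
    List.length_pos_iff.2 (hclosed _ (List.get_mem a i)).1
  have hsub : ∀ i : Fin a.length, edgeFinset (a.get i) ⊆ sentEdgeFinset a := fun i =>
    edgeFinset_subset_sentEdgeFinset (List.get_mem a i)
  have hmem : ∀ (i : Fin a.length) e, trav (a.get i) e ≠ 0 ↔ e ∈ edgeFinset (a.get i) := by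
    intro i e
    rw [trav, edgeFinset, List.mem_toFinset, Ne, List.count_eq_zero, not_not]
  have key := two_mul_card_add_card_le_sum (fun i : Fin a.length => trav (a.get i)) hTE
    (fun e he => sentTrav_eq_sum a e ▸ htwo e he)
    (fun i hi => by
      obtain ⟨-, hhead, hlast, -⟩ := hclosed _ (List.get_mem a i)
      refine hT.even_trav hhead hlast fun e he => ?_
      by_contra heT
      exact (hmem i e).2 he (hi e (Finset.mem_sdiff.2 ⟨hsub i he, heT⟩)))
    (fun i => by
      obtain ⟨j, hj, e, he⟩ := hshare i
      obtain ⟨hei, hej⟩ := Finset.mem_inter.1 he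
      exact ⟨j, hj, e, hsub i hei, (hmem i e).2 hei, (hmem j e).2 hej⟩)
  have hcard : (sentSupp a).card ≤ T.card + 1 :=
    hT.1 ▸ Finset.card_le_card Finset.subset_union_right
  have hlen : ∑ i : Fin a.length, ∑ e ∈ sentEdgeFinset a, trav (a.get i) e
      = ∑ i : Fin a.length, ((a.get i).length - 1) :=
    Finset.sum_congr rfl fun i _ => sum_trav_eq_length (hsub i)
  rw [hlen, Fintype.card_fin] at key
  have hcast : ((∑ i : Fin a.length, ((a.get i).length - 1) : ℕ) : ℚ)
      = 2 * ∑ i : Fin a.length, (((a.get i).length : ℚ) - 2) / 2 + a.length := by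
    rw [Nat.cast_sum, Finset.mul_sum]
    have hconst : (a.length : ℚ) = ∑ _i : Fin a.length, (1 : ℚ) := by simp
    rw [hconst, ← Finset.sum_add_distrib]
    refine Finset.sum_congr rfl fun i _ => ?_
    rw [Nat.cast_sub (hpos i)]
    push_cast
    ring
  have keyQ : (2 * T.card + a.length : ℚ)
      ≤ ((∑ i : Fin a.length, ((a.get i).length - 1) : ℕ) : ℚ) := by exact_mod_cast key
  have hcardQ : ((sentSupp a).card : ℚ) ≤ T.card + 1 := by exact_mod_cast hcard
  linarith
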